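/- arXiv:2408.04338 — 5 statements merged into one kernel-verified Lean document; each statement's English description precedes it below -/
import Mathlib

section
/- Resolvent expansion identity (Lemma 1). Let K be a field, let R ≥ 1 be an integer, and let D : ℕ × ℕ → K satisfy D(u,v) ≠ 0 for all 0 ≤ u, v ≤ R. Then 1/D(R,R) = 1/D(0,0) − Σ_{v=1}^{R} (D(0,v) − D(0,v−1)) / (D(0,v)·D(0,v−1)) − Σ_{u=1}^{R} (D(u,R) − D(u−1,R)) / (D(u,0)·D(u−1,0)) + Σ_{1≤u,v≤R} [ (D(u,R) − D(u−1,R))·(D(u,v) − D(u,v−1)) / (D(u,v)·D(u,v−1)·D(u−1,v)) + (D(u,R) − D(u−1,R))·(D(u−1,v) − D(u−1,v−1)) / (D(u,v−1)·D(u−1,v)·D(u−1,v−1)) ]. -/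
theorem sum_Icc_one_pred_sub {A : Type*} [AddCommGroup A] (f : ℕ → A) (n : ℕ) :
    ∑ k ∈ Finset.Icc 1 n, (f (k - 1) - f k) = f 0 - f n := by
  induction n with
  | zero => simp
  | succ n ih =>
    rw [Finset.sum_Icc_succ_top (by omega), ih, Nat.add_sub_cancel]
    abel

theorem sub_div_mul_eq_one_div_sub {K : Type*} [Field K] {a b : K} (ha : a ≠ 0) (hb : b ≠ 0) :
    (a - b) / (a * b) = 1 / b - 1 / a := by
  field_simp

/-- **Resolvent expansion identity** (Lemma 1). -/
theorem resolvent_expansion {K : Type*} [Field K] (R : ℕ) (hR : 1 ≤ R)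
    (D : ℕ → ℕ → K) (hD : ∀ u v : ℕ, u ≤ R → v ≤ R → D u v ≠ 0) :
    1 / D R R =
      1 / D 0 0
        - (∑ v ∈ Finset.Icc 1 R, (D 0 v - D 0 (v - 1)) / (D 0 v * D 0 (v - 1)))
        - (∑ u ∈ Finset.Icc 1 R, (D u R - D (u - 1) R) / (D u 0 * D (u - 1) 0))
        + ∑ u ∈ Finset.Icc 1 R, ∑ v ∈ Finset.Icc 1 R,
            ((D u R - D (u - 1) R) * (D u v - D u (v - 1)) /
                (D u v * D u (v - 1) * D (u - 1) v)
              + (D u R - D (u - 1) R) * (D (u - 1) v - D (u - 1) (v - 1)) /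
                (D u (v - 1) * D (u - 1) v * D (u - 1) (v - 1))) := by
  have inner : ∀ u ∈ Finset.Icc 1 R, ∑ v ∈ Finset.Icc 1 R,
      ((D u R - D (u - 1) R) * (D u v - D u (v - 1)) /
          (D u v * D u (v - 1) * D (u - 1) v)
        + (D u R - D (u - 1) R) * (D (u - 1) v - D (u - 1) (v - 1)) /
          (D u (v - 1) * D (u - 1) v * D (u - 1) (v - 1))) =
      (D u R - D (u - 1) R) / (D u 0 * D (u - 1) 0) - (1 / D (u - 1) R - 1 / D u R) := by
    intro u hu
    obtain ⟨-, huR⟩ := Finset.mem_Icc.mp hu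
    have hpred : u - 1 ≤ R := by omega
    rw [← sub_div_mul_eq_one_div_sub (hD u R huR le_rfl) (hD (u - 1) R hpred le_rfl),
      ← sum_Icc_one_pred_sub (fun v => (D u R - D (u - 1) R) / (D u v * D (u - 1) v))]
    refine Finset.sum_congr rfl fun v hv => ?_
    obtain ⟨-, hvR⟩ := Finset.mem_Icc.mp hv
    have h₁ := hD u v huR hvR
    have h₂ := hD u (v - 1) huR (by omega)
    have h₃ := hD (u - 1) v hpred hvR
    have h₄ := hD (u - 1) (v - 1) hpred (by omega)
    field_simp
    ring
  have boundary : ∑ v ∈ Finset.Icc 1 R, (D 0 v - D 0 (v - 1)) / (D 0 v * D 0 (v - 1)) =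
      1 / D 0 0 - 1 / D 0 R := by
    rw [← sum_Icc_one_pred_sub (fun v => 1 / D 0 v)]
    refine Finset.sum_congr rfl fun v hv => ?_
    obtain ⟨-, hvR⟩ := Finset.mem_Icc.mp hv
    exact sub_div_mul_eq_one_div_sub (hD 0 v (Nat.zero_le R) hvR)
      (hD 0 (v - 1) (Nat.zero_le R) (by omega))
  rw [Finset.sum_congr rfl inner, Finset.sum_sub_distrib, boundary,
    sum_Icc_one_pred_sub (fun u => 1 / D u R)]
  ring
end

section
/- Smooth approximation of indicator functions (Appendix A Lemma). There exists a universal constant C > 0 with the following property. Let n, p ≥ 1 be integers, let Ω = [0,1]^n ⊂ ℝ^n, let B ≥ 0 and η > 0, and let f_1, …, f_p : ℝ^n → ℝ be C^∞ functions whose partial derivatives satisfy |∂f_k/∂θ_i(θ)| ≤ B for all θ ∈ Ω, all 1 ≤ i ≤ n and all 1 ≤ k ≤ p. Then there exist C^∞ functions Q, S : ℝ^n → ℝ such that for all θ ∈ Ω: (1) 0 ≤ Q(θ) ≤ 1 and 0 ≤ S(θ) ≤ 1; (2) if Q(θ) > 0 then |f_k(θ)| ≤ 2η for all k, and if S(θ)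 > 0 then |f_k(θ)| ≥ η/2 for all k; (3) if |f_k(θ)| ≤ η for all k then Q(θ) = 1, and if |f_k(θ)| ≥ η for all k then S(θ) = 1; (4) |∂Q/∂θ_i(θ)| ≤ C·B·n/η and |∂S/∂θ_i(θ)| ≤ C·B·n/η for all 1 ≤ i ≤ n. -/
/-- The unit cube `Ω = [0,1]^n ⊆ ℝ^n`. -/
def cube (n : ℕ) : Set (Fin n → ℝ) := Set.univ.pi fun _ => Set.Icc (0:ℝ) 1

open MeasureTheory in
/-- A real Lipschitz function on `ℝ^n` is uniformly approximated by smooth functions with the same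
Lipschitz constant. -/
theorem LipschitzWith.exists_contDiff_dist_le {n : ℕ} {K : NNReal} {g : (Fin n → ℝ) → ℝ}
    (hg : LipschitzWith K g) {ε : ℝ} (hε : 0 < ε) :
    ∃ M : (Fin n → ℝ) → ℝ, ContDiff ℝ (⊤ : ℕ∞) M ∧ LipschitzWith K M ∧
      ∀ x, |M x - g x| ≤ ε := by
  have hK : (0 : ℝ) < K + 1 := by positivity
  let φ : ContDiffBump (0 : Fin n → ℝ) :=
    ⟨ε / (K + 1) / 2, ε / (K + 1), by positivity, half_lt_self (by positivity)⟩
  have hgc : Continuous g := hg.continuous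
  have hφg (x : Fin n → ℝ) : Integrable (fun t => φ.normed volume t * g (x - t)) volume :=
    (φ.continuous_normed.mul
      (hgc.comp (continuous_const.sub continuous_id))).integrable_of_hasCompactSupport
      φ.hasCompactSupport_normed.mul_right
  refine ⟨convolution (φ.normed volume) g (ContinuousLinearMap.lsmul ℝ ℝ) volume,
    φ.hasCompactSupport_normed.contDiff_convolution_left _ φ.contDiff_normed
      hgc.locallyIntegrable, ?_, fun x => ?_⟩
  · refine LipschitzWith.of_dist_le_mul fun x y => ?_
    simp only [convolution_def, ContinuousLinearMap.lsmul_apply, smul_eq_mul]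
    rw [Real.dist_eq, ← integral_sub (hφg x) (hφg y), ← Real.norm_eq_abs]
    calc _ ≤ ∫ t, φ.normed volume t * (K * dist x y) := by
          refine norm_integral_le_of_norm_le (φ.integrable_normed.mul_const _) (.of_forall fun t => ?_)
          rw [← mul_sub, norm_mul, Real.norm_of_nonneg (φ.nonneg_normed t), ← dist_eq_norm]
          refine mul_le_mul_of_nonneg_left ?_ (φ.nonneg_normed t)
          simpa using hg.dist_le_mul (x - t) (y - t)
      _ = K * dist x y := by rw [integral_mul_const, φ.integral_normed, one_mul]
  · rw [← Real.dist_eq]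
    refine φ.dist_normed_convolution_le hgc.aestronglyMeasurable fun y hy => ?_
    calc dist (g y) (g x) ≤ K * dist y x := hg.dist_le_mul y x
      _ ≤ (K + 1) * (ε / (K + 1)) := by
        gcongr
        · linarith
        · exact (Metric.mem_ball.1 hy).le
      _ = ε := by field_simp

/-- The derivative of `Real.smoothTransition` is bounded. -/
theorem Real.smoothTransition.exists_lipschitzWith :
    ∃ K : NNReal, LipschitzWith K Real.smoothTransition := by
  have hd : Differentiable ℝ Real.smoothTransition :=
    (Real.smoothTransition.contDiff (n := 1)).differentiable one_ne_zero
  have hc : Continuous (deriv Real.smoothTransition) :=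
    (Real.smoothTransition.contDiff (n := 1)).continuous_deriv le_rfl
  have hs : HasCompactSupport (deriv Real.smoothTransition) := by
    refine HasCompactSupport.intro (isCompact_Icc (a := (0 : ℝ)) (b := 1)) fun x hx => ?_
    rw [Set.mem_Icc, not_and_or, not_le, not_le] at hx
    rcases hx with hx | hx
    · have : Real.smoothTransition =ᶠ[nhds x] fun _ => 0 := by
        filter_upwards [Iio_mem_nhds hx] with y hy
        exact Real.smoothTransition.zero_of_nonpos (le_of_lt hy)
      rw [this.deriv_eq, deriv_const]
    · have : Real.smoothTransition =ᶠ[nhds x] fun _ => 1 := by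
        filter_upwards [Ioi_mem_nhds hx] with y hy
        exact Real.smoothTransition.one_of_one_le (le_of_lt hy)
      rw [this.deriv_eq, deriv_const]
  obtain ⟨K, hK⟩ := hs.exists_bound_of_continuous hc
  refine ⟨K.toNNReal, lipschitzWith_of_nnnorm_deriv_le hd fun x => ?_⟩
  rw [← NNReal.coe_le_coe, coe_nnnorm]
  exact (hK x).trans (Real.le_coe_toNNReal K)

/-- In the sup norm, the norm of a functional is at most `n` times the largest coefficient. -/
theorem ContinuousLinearMap.norm_le_of_abs_apply_single_le {n : ℕ} {B : ℝ} (hB : 0 ≤ B)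
    (L : (Fin n → ℝ) →L[ℝ] ℝ) (h : ∀ i, |L (Pi.single i 1)| ≤ B) : ‖L‖ ≤ B * n := by
  refine L.opNorm_le_bound (by positivity) fun v => ?_
  have hv : L v = ∑ i, v i * L (Pi.single i 1) := by
    conv_lhs => rw [← Finset.univ_sum_single v, map_sum]
    refine Finset.sum_congr rfl fun i _ => ?_
    rw [← smul_eq_mul, ← map_smul, ← Pi.single_smul, smul_eq_mul, mul_one]
  calc ‖L v‖ ≤ ∑ i, ‖v i * L (Pi.single i 1)‖ := hv ▸ norm_sum_le _ _
    _ ≤ ∑ _i : Fin n, ‖v‖ * B := by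
      refine Finset.sum_le_sum fun i _ => ?_
      rw [norm_mul]
      exact mul_le_mul (norm_le_pi_norm v i) (h i) (norm_nonneg _) (norm_nonneg _)
    _ = B * n * ‖v‖ := by
      rw [Finset.sum_const, Finset.card_univ, Fintype.card_fin, nsmul_eq_mul]; ring

theorem convex_cube (n : ℕ) : Convex ℝ (cube n) :=
  convex_pi fun _ _ => convex_Icc 0 1

/-- A finite infimum of `K`-Lipschitz functions is `K`-Lipschitz. -/
theorem LipschitzOnWith.ciInf {ι E : Type*} [Finite ι] [Nonempty ι] [PseudoMetricSpace E]
    {K : NNReal} {s : Set E} {f : ι → E → ℝ} (hf : ∀ k, LipschitzOnWith K (f k) s) :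
    LipschitzOnWith K (fun x => ⨅ k, f k x) s := by
  refine LipschitzOnWith.of_le_add_mul K fun x hx y hy => ?_
  rw [← sub_le_iff_le_add]
  refine le_ciInf fun k => sub_le_iff_le_add.2 ?_
  exact (ciInf_le (Set.finite_range _).bddBelow k).trans ((hf k).le_add_mul hx hy)

/-- A Lipschitz function on a subset of `ℝ^n` can be composed with a smooth step, up to a small error in the
argument, so that the result is smooth with controlled derivative. -/
theorem LipschitzOnWith.exists_contDiff_smoothTransition {n : ℕ} {T K : NNReal}
    (hT : LipschitzWith T Real.smoothTransition) {s : Set (Fin n → ℝ)} {m : (Fin n → ℝ) → ℝ}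
    (hm : LipschitzOnWith K m s) {η : ℝ} (hη : 0 < η) (a : ℝ) :
    ∃ S : (Fin n → ℝ) → ℝ, ContDiff ℝ (⊤ : ℕ∞) S ∧ (∀ θ, 0 ≤ S θ ∧ S θ ≤ 1) ∧
      (∀ θ ∈ s, 0 < S θ → a ≤ m θ) ∧ (∀ θ ∈ s, a + η / 2 ≤ m θ → S θ = 1) ∧
      ∀ θ i, |fderiv ℝ S θ (Pi.single i 1)| ≤ 4 * T * K / η := by
  obtain ⟨g, hg, hgm⟩ := hm.extend_real
  obtain ⟨M, hM, hMl, hMg⟩ := hg.exists_contDiff_dist_le (ε := η / 8) (by positivity)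
  have hl : LipschitzWith (T * (Real.toNNReal (4 / η) * K))
      fun θ => Real.smoothTransition (4 / η * (M θ - a - η / 8)) := by
    refine hT.comp (LipschitzWith.of_dist_le_mul fun x y => ?_)
    rw [Real.dist_eq, ← mul_sub, abs_mul, abs_of_pos (by positivity), NNReal.coe_mul,
      Real.coe_toNNReal _ (by positivity), mul_assoc]
    refine mul_le_mul_of_nonneg_left ?_ (by positivity)
    simpa [Real.dist_eq] using hMl.dist_le_mul x y
  refine ⟨fun θ => Real.smoothTransition (4 / η * (M θ - a - η / 8)), ?_,
    fun θ => ⟨Real.smoothTransition.nonneg _, Real.smoothTransition.le_one _⟩, ?_, ?_, ?_⟩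
  · exact Real.smoothTransition.contDiff.comp
      (contDiff_const.mul ((hM.sub contDiff_const).sub contDiff_const))
  · intro θ hθ hpos
    have := abs_le.1 (hMg θ)
    rw [← hgm hθ] at this
    by_contra! hlt
    refine hpos.ne' (Real.smoothTransition.zero_of_nonpos ?_)
    exact mul_nonpos_of_nonneg_of_nonpos (by positivity) (by linarith)
  · intro θ hθ hle
    have := abs_le.1 (hMg θ)
    rw [← hgm hθ] at this
    refine Real.smoothTransition.one_of_one_le ?_
    rw [div_mul_eq_mul_div, one_le_div hη]
    linarith
  · intro θ i
    have h := (fderiv ℝ (fun θ => Real.smoothTransition (4 / η * (M θ - a - η / 8))) θ).le_opNorm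
      (Pi.single i 1)
    rw [Pi.norm_single, norm_one, mul_one] at h
    refine (h.trans (norm_fderiv_le_of_lipschitz ℝ hl)).trans_eq ?_
    rw [NNReal.coe_mul, NNReal.coe_mul, Real.coe_toNNReal _ (by positivity)]
    ring

/-- **Smooth approximation of indicator functions** (Appendix A Lemma). -/
theorem smooth_indicator_approximation :
    ∃ C : ℝ, 0 < C ∧
      ∀ (n p : ℕ), 1 ≤ n → 1 ≤ p →
      ∀ (B η : ℝ), 0 ≤ B → 0 < η →
      ∀ f : Fin p → ((Fin n → ℝ) → ℝ),
        (∀ k, ContDiff ℝ (⊤ : ℕ∞) (f k)) →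
        (∀ k i, ∀ θ ∈ cube n, |fderiv ℝ (f k) θ (Pi.single i 1)| ≤ B) →
        ∃ Q S : (Fin n → ℝ) → ℝ,
          ContDiff ℝ (⊤ : ℕ∞) Q ∧ ContDiff ℝ (⊤ : ℕ∞) S ∧
          (∀ θ ∈ cube n, 0 ≤ Q θ ∧ Q θ ≤ 1 ∧ 0 ≤ S θ ∧ S θ ≤ 1) ∧
          (∀ θ ∈ cube n, 0 < Q θ → ∀ k, |f k θ| ≤ 2 * η) ∧
          (∀ θ ∈ cube n, 0 < S θ → ∀ k, η / 2 ≤ |f k θ|) ∧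
          (∀ θ ∈ cube n, (∀ k, |f k θ| ≤ η) → Q θ = 1) ∧
          (∀ θ ∈ cube n, (∀ k, η ≤ |f k θ|) → S θ = 1) ∧
          (∀ θ ∈ cube n, ∀ i,
            |fderiv ℝ Q θ (Pi.single i 1)| ≤ C * B * n / η ∧
            |fderiv ℝ S θ (Pi.single i 1)| ≤ C * B * n / η) := by
  obtain ⟨T, hT⟩ := Real.smoothTransition.exists_lipschitzWith
  refine ⟨4 * T + 1, by positivity, fun n p _ hp B η hB hη f hf hfB => ?_⟩
  have : Nonempty (Fin p) := ⟨⟨0, hp⟩⟩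
  have hK : (((B * n).toNNReal : NNReal) : ℝ) = B * n := Real.coe_toNNReal _ (by positivity)
  have hlip (k : Fin p) : LipschitzOnWith (B * n).toNNReal (fun θ => |f k θ|) (cube n) := by
    have h : LipschitzOnWith (B * n).toNNReal (f k) (cube n) := by
      refine (convex_cube n).lipschitzOnWith_of_nnnorm_fderiv_le (𝕜 := ℝ)
        (fun θ _ => ((hf k).differentiable (by simp)).differentiableAt) fun θ hθ => ?_
      rw [← NNReal.coe_le_coe, coe_nnnorm, hK]
      exact ContinuousLinearMap.norm_le_of_abs_apply_single_le hB _ fun i => hfB k i θ hθ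
    simpa [Function.comp_def] using (lipschitzWith_one_norm (E := ℝ)).comp_lipschitzOnWith h
  have hneg (k : Fin p) : LipschitzOnWith (B * n).toNNReal (fun θ => -|f k θ|) (cube n) :=
    (hlip k).neg
  obtain ⟨Q, hQ, hQ01, hQpos, hQone, hQd⟩ :=
    (LipschitzOnWith.ciInf hneg).exists_contDiff_smoothTransition hT hη (-(2 * η))
  obtain ⟨S, hS, hS01, hSpos, hSone, hSd⟩ :=
    (LipschitzOnWith.ciInf hlip).exists_contDiff_smoothTransition hT hη (η / 2)
  have hC : 4 * T * (B * n).toNNReal / η ≤ (4 * T + 1) * B * n / η := by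
    rw [hK, mul_assoc (4 * (T : ℝ) + 1)]
    gcongr
    linarith
  refine ⟨Q, S, hQ, hS, fun θ _ => ⟨(hQ01 θ).1, (hQ01 θ).2, hS01 θ⟩, fun θ hθ h k => ?_,
    fun θ hθ h k => ?_, fun θ hθ h => hQone θ hθ (le_ciInf fun k => ?_),
    fun θ hθ h => hSone θ hθ (le_ciInf fun k => ?_),
    fun θ _ i => ⟨(hQd θ i).trans hC, (hSd θ i).trans hC⟩⟩
  · exact neg_le_neg_iff.1 ((hQpos θ hθ h).trans (ciInf_le (Set.finite_range _).bddBelow k))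
  · exact (hSpos θ hθ h).trans (ciInf_le (Set.finite_range _).bddBelow k)
  · linarith [h k]
  · linarith [h k]
end

section
/- Three-interval covering lemma (core of the lemma on three weakly adjacent diagrams). Let T₁, T₂, T₃ be nonempty finite discrete intervals in ℤ such that the union T_i ∪ T_j is again a discrete interval for every pair i ≠ j. Then there exists an index i ∈ {1,2,3} such that T_i ⊆ ⋃_{j ≠ i} T_j. -/
/-- **Three-interval covering lemma.** If `T₁, T₂, T₃` are nonempty finite discrete intervals
in `ℤ` whose pairwise unions are again discrete intervals, then one of them is contained in
the union of the other two. -/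
theorem three_interval_cover (T : Fin 3 → Finset ℤ)
    (hT : ∀ i, ∃ a b : ℤ, a ≤ b ∧ T i = Finset.Icc a b)
    (hUnion : ∀ i j, i ≠ j → ∃ a b : ℤ, a ≤ b ∧ T i ∪ T j = Finset.Icc a b) :
    ∃ i : Fin 3, T i ⊆ (Finset.univ.erase i).biUnion T := by
  choose a b hab hT using hT
  obtain ⟨i, hi⟩ := Finite.exists_min a
  obtain ⟨j, hj⟩ := Finite.exists_max b
  obtain ⟨k, hik, hjk⟩ : ∃ k, i ≠ k ∧ j ≠ k := by
    clear hi hj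
    decide +revert
  -- `T i ∪ T j` is an interval containing the least left and the greatest right endpoint.
  obtain ⟨c, d, hcd⟩ : ∃ c d : ℤ, T i ∪ T j = Finset.Icc c d := by
    by_cases hij : i = j
    · exact ⟨a i, b i, by rw [← hij, Finset.union_self, hT]⟩
    · obtain ⟨c, d, -, h⟩ := hUnion i j hij
      exact ⟨c, d, h⟩
  have hc : a i ∈ Finset.Icc c d := by
    rw [← hcd, Finset.mem_union, hT i]
    exact Or.inl (Finset.left_mem_Icc.2 (hab i))
  have hd : b j ∈ Finset.Icc c d := by
    rw [← hcd, Finset.mem_union, hT j]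
    exact Or.inr (Finset.right_mem_Icc.2 (hab j))
  have hk : T k ⊆ T i ∪ T j := by
    rw [hcd, hT k]
    exact Finset.Icc_subset_Icc ((Finset.mem_Icc.1 hc).1.trans (hi k))
      ((hj k).trans (Finset.mem_Icc.1 hd).2)
  exact ⟨k, hk.trans (Finset.union_subset
    (Finset.subset_biUnion_of_mem T (Finset.mem_erase.2 ⟨hik, Finset.mem_univ i⟩))
    (Finset.subset_biUnion_of_mem T (Finset.mem_erase.2 ⟨hjk, Finset.mem_univ j⟩)))⟩
end

section
/- Covering lemma for three intervals adjacent to a common interval (core of the lemma 'three diagrams adjacent to something'). Let A, B, C, D be nonempty finite discrete intervals in ℤ such that each of the unions A ∪ D, B ∪ D and C ∪ D is again a discrete interval. Then one of A, B, C is contained in the union of the other two together with D; that is, there is X ∈ {A, B, C} with X ⊆ (⋃ of the two remaining intervals) ∪ D. -/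
/-- If `A ∪ D` and `B ∪ D` are order-connected, then private points `x` of `A` and `y` of `B` lie
on different sides of every point `d` of `D`. -/
theorem Set.OrdConnected.lt_iff_lt_of_union {α : Type*} [LinearOrder α] {A B D : Set α}
    (hA : (A ∪ D).OrdConnected) (hB : (B ∪ D).OrdConnected) {x y d : α} (hd : d ∈ D)
    (hxA : x ∈ A) (hxB : x ∉ B ∪ D) (hyB : y ∈ B) (hyA : y ∉ A ∪ D) : x < d ↔ d < y := by
  have hx : x ≠ d := fun h => hxB (Or.inr (h ▸ hd))
  have hy : y ≠ d := fun h => hyA (Or.inr (h ▸ hd))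
  constructor
  · intro h
    by_contra! hyd
    rcases le_total x y with hxy | hxy
    · exact hyA (hA.out (Or.inl hxA) (Or.inr hd) ⟨hxy, hyd⟩)
    · exact hxB (hB.out (Or.inl hyB) (Or.inr hd) ⟨hxy, h.le⟩)
  · intro h
    by_contra! hdx
    rcases le_total x y with hxy | hxy
    · exact hxB (hB.out (Or.inr hd) (Or.inl hyB) ⟨hdx, hxy⟩)
    · exact hyA (hA.out (Or.inr hd) (Or.inl hxA) ⟨h.le, hxy⟩)

/-- If `D` is nonempty and its union with each of `A`, `B`, `C` is order-connected, then one of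
`A`, `B`, `C` is contained in the union of the other two with `D`. -/
theorem Set.OrdConnected.subset_union_of_three {α : Type*} [LinearOrder α] {A B C D : Set α}
    (hD : D.Nonempty) (hA : (A ∪ D).OrdConnected) (hB : (B ∪ D).OrdConnected)
    (hC : (C ∪ D).OrdConnected) : A ⊆ B ∪ C ∪ D ∨ B ⊆ A ∪ C ∪ D ∨ C ⊆ A ∪ B ∪ D := by
  by_contra! h
  simp only [Set.not_subset] at h
  obtain ⟨⟨x, hxA, hx⟩, ⟨y, hyB, hy⟩, ⟨z, hzC, hz⟩⟩ := h
  obtain ⟨d, hd⟩ := hD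
  simp only [Set.mem_union, not_or] at hx hy hz
  have hxy := hA.lt_iff_lt_of_union hB hd hxA (by simp [hx]) hyB (by simp [hy])
  have hxz := hA.lt_iff_lt_of_union hC hd hxA (by simp [hx]) hzC (by simp [hz])
  have hyz := hB.lt_iff_lt_of_union hC hd hyB (by simp [hy]) hzC (by simp [hz])
  have hyd : y ≠ d := fun h => hy.2 (h ▸ hd)
  rcases lt_or_gt_of_ne hyd with h | h
  · exact (hxy.1 (hxz.2 (hyz.1 h))).not_gt h
  · exact (hyz.2 (hxz.1 (hxy.2 h))).not_gt h

/-- **Covering lemma for three intervals adjacent to a common interval.**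
If `A, B, C, D` are nonempty finite discrete intervals in `ℤ` such that each of the unions
`A ∪ D`, `B ∪ D`, `C ∪ D` is again a discrete interval, then one of `A, B, C` is contained
in the union of the other two together with `D`. -/
theorem three_adjacent_cover (A B C D : Finset ℤ)
    (hA : ∃ a b : ℤ, a ≤ b ∧ A = Finset.Icc a b)
    (hB : ∃ a b : ℤ, a ≤ b ∧ B = Finset.Icc a b)
    (hC : ∃ a b : ℤ, a ≤ b ∧ C = Finset.Icc a b)
    (hD : ∃ a b : ℤ, a ≤ b ∧ D = Finset.Icc a b)
    (hAD : ∃ a b : ℤ, a ≤ b ∧ A ∪ D = Finset.Icc a b)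
    (hBD : ∃ a b : ℤ, a ≤ b ∧ B ∪ D = Finset.Icc a b)
    (hCD : ∃ a b : ℤ, a ≤ b ∧ C ∪ D = Finset.Icc a b) :
    A ⊆ B ∪ C ∪ D ∨ B ⊆ A ∪ C ∪ D ∨ C ⊆ A ∪ B ∪ D := by
  have ordConnected_of_eq_Icc {S T : Finset ℤ} (h : ∃ a b : ℤ, a ≤ b ∧ S ∪ T = Finset.Icc a b) :
      ((S : Set ℤ) ∪ T).OrdConnected := by
    obtain ⟨a, b, -, h⟩ := h
    rw [← Finset.coe_union, h, Finset.coe_Icc]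
    exact Set.ordConnected_Icc
  have hD' : (D : Set ℤ).Nonempty := by
    obtain ⟨a, b, hab, rfl⟩ := hD
    exact Finset.coe_nonempty.2 (Finset.nonempty_Icc.2 hab)
  exact_mod_cast Set.OrdConnected.subset_union_of_three hD' (ordConnected_of_eq_Icc hAD)
    (ordConnected_of_eq_Icc hBD) (ordConnected_of_eq_Icc hCD)
end

section
/- Fractional moment integral bound. Let n ≥ 1 be an integer, fix a coordinate x₀ ∈ {1, …, n}, let κ > 0 and 0 < α < 1, and let f : ℝ^n → ℝ be a C¹ function such that |∂f/∂θ_{x₀}(θ)| ≥ κ for every θ in the unit cube [0,1]^n. Then ∫_{[0,1]^n} |f(θ)|^{−α} dθ ≤ 1 + 2α / (κ·(1 − α)). -/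
open MeasureTheory

/-- A linear anti-concentration estimate at `0` bounds the negative moments of order `α < 1`. -/
theorem lintegral_abs_rpow_neg_le_of_measure_abs_le {Ω : Type*} [MeasurableSpace Ω]
    (μ : Measure Ω) [IsProbabilityMeasure μ] {g : Ω → ℝ} (hg : Measurable g) {c α : ℝ}
    (hc : 0 ≤ c) (hα0 : 0 < α) (hα1 : α < 1)
    (h : ∀ t : ℝ, 0 < t → μ {x | |g x| ≤ t} ≤ ENNReal.ofReal (c * t)) :
    ∫⁻ x, (ENNReal.ofReal |g x|) ^ (-α) ∂μ ≤ ENNReal.ofReal (1 + c * (α / (1 - α))) := by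
  have hzero : μ {x | g x = 0} = 0 := by
    refine le_antisymm ?_ zero_le
    have hlim : Filter.Tendsto (fun t : ℝ => ENNReal.ofReal (c * t)) (nhdsWithin 0 (Set.Ioi 0))
        (nhds 0) := by
      have : Continuous fun t : ℝ => ENNReal.ofReal (c * t) :=
        ENNReal.continuous_ofReal.comp (continuous_const_mul c)
      simpa using (this.tendsto 0).mono_left nhdsWithin_le_nhds
    refine ge_of_tendsto hlim ?_
    filter_upwards [self_mem_nhdsWithin] with t ht
    refine (measure_mono fun x hx => ?_).trans (h t ht)
    have hx : g x = 0 := hx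
    simpa [hx] using le_of_lt ht
  have hpos : ∀ᵐ x ∂μ, g x ≠ 0 := by
    rw [ae_iff]
    simpa using hzero
  have hae : ∫⁻ x, (ENNReal.ofReal |g x|) ^ (-α) ∂μ = ∫⁻ x, ENNReal.ofReal (|g x| ^ (-α)) ∂μ := by
    refine lintegral_congr_ae ?_
    filter_upwards [hpos] with x hx
    exact ENNReal.ofReal_rpow_of_pos (abs_pos.2 hx)
  have hexp : -α⁻¹ < -1 := neg_lt_neg ((one_lt_inv₀ hα0).2 hα1)
  have htail : ∀ t : ℝ, 0 < t → μ {x | t < |g x| ^ (-α)} ≤ ENNReal.ofReal (c * t ^ (-α⁻¹)) := by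
    intro t ht
    refine (measure_mono fun x hx => ?_).trans (h (t ^ (-α⁻¹)) (Real.rpow_pos_of_pos ht _))
    have hx : t < |g x| ^ (-α) := hx
    change |g x| ≤ t ^ (-α⁻¹)
    rcases (abs_nonneg (g x)).eq_or_lt with h0 | h0
    · rw [← h0]
      positivity
    · have := Real.rpow_le_rpow_of_nonpos ht hx.le (by rw [neg_nonpos]; positivity : -α⁻¹ ≤ 0)
      rwa [← Real.rpow_mul h0.le, neg_mul_neg, mul_inv_cancel₀ hα0.ne', Real.rpow_one] at this
  rw [hae, lintegral_eq_lintegral_meas_lt μ (Filter.Eventually.of_forall fun x => by positivity)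
    (by fun_prop), ← Set.Ioc_union_Ioi_eq_Ioi zero_le_one,
    lintegral_union measurableSet_Ioi (Set.Ioc_disjoint_Ioi le_rfl),
    ENNReal.ofReal_add zero_le_one (by have := sub_pos.2 hα1; positivity)]
  refine add_le_add ?_ ?_
  · calc ∫⁻ t in Set.Ioc (0 : ℝ) 1, μ {x | t < |g x| ^ (-α)}
        ≤ ∫⁻ _ in Set.Ioc (0 : ℝ) 1, 1 := lintegral_mono fun _ => prob_le_one
      _ = ENNReal.ofReal 1 := by simp
  · calc ∫⁻ t in Set.Ioi (1 : ℝ), μ {x | t < |g x| ^ (-α)}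
        ≤ ∫⁻ t in Set.Ioi (1 : ℝ), ENNReal.ofReal (c * t ^ (-α⁻¹)) :=
          setLIntegral_mono (by fun_prop) fun t ht => htail t (zero_lt_one.trans ht)
      _ = ENNReal.ofReal (∫ t in Set.Ioi (1 : ℝ), c * t ^ (-α⁻¹)) := by
          refine (ofReal_integral_eq_lintegral_ofReal
            ((integrableOn_Ioi_rpow_of_lt hexp zero_lt_one).const_mul c) ?_).symm
          filter_upwards [ae_restrict_mem measurableSet_Ioi] with t ht
          have : (0 : ℝ) < t := zero_lt_one.trans ht
          change 0 ≤ c * t ^ (-α⁻¹)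
          positivity
      _ = ENNReal.ofReal (c * (α / (1 - α))) := by
          rw [integral_const_mul, integral_Ioi_rpow_of_lt hexp zero_lt_one, Real.one_rpow]
          have h1 : 1 - α ≠ 0 := (sub_pos.2 hα1).ne'
          have h2 : -α⁻¹ + 1 ≠ 0 := by linarith
          have h3 : -1 / (-α⁻¹ + 1) = α / (1 - α) := by
            rw [div_eq_div_iff h2 h1]
            field_simp
            ring
          rw [h3]

/-- A function that expands distances on `s` by a factor `κ` is small only on a short subset. -/
theorem volume_restrict_abs_le_of_expanding {g : ℝ → ℝ} {s : Set ℝ} (hs : MeasurableSet s)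
    {κ : ℝ} (hκ : 0 < κ) (h : ∀ x ∈ s, ∀ y ∈ s, κ * |x - y| ≤ |g x - g y|) (t : ℝ) :
    volume.restrict s {x | |g x| ≤ t} ≤ ENNReal.ofReal (2 / κ * t) := by
  rw [Measure.restrict_apply' hs]
  refine (Real.volume_le_diam _).trans (Metric.ediam_le fun x hx y hy => ?_)
  rw [edist_dist, Real.dist_eq]
  refine ENNReal.ofReal_le_ofReal ?_
  have hxy := h x hx.2 y hy.2
  have hsum : |g x - g y| ≤ t + t := (abs_sub _ _).trans (add_le_add hx.1 hy.1)
  rw [div_mul_eq_mul_div, le_div_iff₀ hκ]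
  linarith

/-- A lower bound on the absolute value of the derivative on a convex set makes the function
expand distances there. -/
theorem mul_abs_sub_le_of_le_abs_deriv {g g' : ℝ → ℝ} {s : Set ℝ} (hs : s.OrdConnected)
    {κ : ℝ} (hg : ∀ x ∈ s, HasDerivAt g (g' x) x) (hκ : ∀ x ∈ s, κ ≤ |g' x|) :
    ∀ x ∈ s, ∀ y ∈ s, κ * |x - y| ≤ |g x - g y| := by
  have key : ∀ x ∈ s, ∀ y ∈ s, x < y → κ * |x - y| ≤ |g x - g y| := by
    intro x hx y hy hxy
    have hsub : Set.Icc x y ⊆ s := hs.out hx hy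
    obtain ⟨z, hz, hzeq⟩ := exists_hasDerivAt_eq_slope g g' hxy
      (fun w hw => (hg w (hsub hw)).continuousAt.continuousWithinAt)
      (fun w hw => hg w (hsub (Set.Ioo_subset_Icc_self hw)))
    have hmul : g y - g x = g' z * (y - x) := by
      rw [hzeq, div_mul_cancel₀ _ (sub_pos.2 hxy).ne']
    rw [abs_sub_comm x, abs_sub_comm (g x), hmul, abs_mul]
    exact mul_le_mul_of_nonneg_right (hκ z (hsub (Set.Ioo_subset_Icc_self hz))) (abs_nonneg _)
  intro x hx y hy
  rcases lt_trichotomy x y with hxy | rfl | hxy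
  · exact key x hx y hy hxy
  · simp
  · rw [abs_sub_comm x, abs_sub_comm (g x)]
    exact key y hy x hx hxy

/-- **Fractional moment integral bound.** If a `C¹` function `f` on `ℝ^n` has
`|∂f/∂θ_{x₀}| ≥ κ > 0` throughout the unit cube, then for `0 < α < 1`,
`∫_{[0,1]^n} |f|^{−α} ≤ 1 + 2α/(κ(1−α))`. -/
theorem fractional_moment_bound (n : ℕ) (hn : 1 ≤ n) (x₀ : Fin n) (κ α : ℝ)
    (hκ : 0 < κ) (hα0 : 0 < α) (hα1 : α < 1)
    (f : (Fin n → ℝ) → ℝ) (hf : ContDiff ℝ 1 f)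
    (hder : ∀ θ ∈ cube n, κ ≤ |fderiv ℝ f θ (Pi.single x₀ 1)|) :
    ∫⁻ θ in cube n, (ENNReal.ofReal |f θ|) ^ (-α) ∂volume ≤
      ENNReal.ofReal (1 + 2 * α / (κ * (1 - α))) := by
  have hfm : Measurable f := hf.continuous.measurable
  have hcube : MeasurableSet (cube n) := MeasurableSet.univ_pi fun _ => measurableSet_Icc
  set C := ENNReal.ofReal (1 + 2 * α / (κ * (1 - α))) with hC
  set F : (Fin n → ℝ) → ENNReal := fun θ => (ENNReal.ofReal |f θ|) ^ (-α)
  have hF : Measurable F := by fun_prop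
  let ν : Fin n → Measure ℝ := fun _ => volume.restrict (Set.Icc 0 1)
  have : IsProbabilityMeasure (volume.restrict (Set.Icc (0 : ℝ) 1)) := ⟨by simp⟩
  have : ∀ i, IsProbabilityMeasure (ν i) := fun _ => this
  have hν : (volume : Measure (Fin n → ℝ)).restrict (cube n) = Measure.pi ν :=
    Measure.restrict_pi_pi _ _
  have hind : ∫⁻ θ in cube n, F θ = ∫⁻ θ in cube n, (cube n).indicator F θ :=
    setLIntegral_congr_fun hcube fun θ hθ => (Set.indicator_of_mem hθ F).symm
  rw [hind, hν]
  refine (lintegral_le_of_lmarginal_le {x₀} (hF.indicator hcube)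
    (measurable_const (a := C)) fun θ => ?_).trans (by simp)
  rw [lmarginal_singleton, lmarginal_singleton]
  refine le_trans ?_ (by simp : C ≤ ∫⁻ _, C ∂ν x₀)
  by_cases hθ : ∀ j, j ≠ x₀ → θ j ∈ Set.Icc (0 : ℝ) 1
  · have hmem : ∀ x ∈ Set.Icc (0 : ℝ) 1, Function.update θ x₀ x ∈ cube n := by
      intro x hx j _
      rcases eq_or_ne j x₀ with rfl | hj
      · simpa using hx
      · simpa [hj] using hθ j hj
    have hderiv (x : ℝ) : HasDerivAt (fun x => f (Function.update θ x₀ x))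
        (fderiv ℝ f (Function.update θ x₀ x) (Pi.single x₀ 1)) x :=
      ((hf.differentiable one_ne_zero _).hasFDerivAt).comp_hasDerivAt x (hasDerivAt_update θ x₀ x)
    have hexpand := mul_abs_sub_le_of_le_abs_deriv (s := Set.Icc 0 1) Set.ordConnected_Icc
      (fun x _ => hderiv x) (fun x hx => hder _ (hmem x hx))
    calc ∫⁻ x, (cube n).indicator F (Function.update θ x₀ x) ∂ν x₀
        ≤ ∫⁻ x, F (Function.update θ x₀ x) ∂ν x₀ :=
          lintegral_mono fun x => Set.indicator_le_self _ _ _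
      _ ≤ ENNReal.ofReal (1 + 2 / κ * (α / (1 - α))) :=
          lintegral_abs_rpow_neg_le_of_measure_abs_le (ν x₀)
            (hfm.comp (measurable_update θ)) (by positivity) hα0 hα1
            fun t _ => volume_restrict_abs_le_of_expanding measurableSet_Icc hκ hexpand t
      _ = C := by rw [hC, div_mul_div_comm]
  · push Not at hθ
    obtain ⟨j, hj, hjθ⟩ := hθ
    have hzero (x : ℝ) : (cube n).indicator F (Function.update θ x₀ x) = 0 := by
      refine Set.indicator_of_notMem (fun hx => hjθ ?_) _
      simpa [hj] using hx j (Set.mem_univ j)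
    simp [hzero]
end
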